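/- Under the RA model with W irreducible: for any δ ∈ (0,1/2) and every agent i ∈ {1, …, N}, lim_{t→∞} P(C_{t,i}(δ)) = 1; that is, the probability that x_{t,i} lies in [0,δ) ∪ (1−δ,1] tends to 1 as t → ∞. -/

import Mathlib

open MeasureTheory ProbabilityTheory Filter

namespace RA

variable {Ω : Type*}

/-- History σ-algebra generated by `x 1, …, x t` and `a 1, …, a (t-1)`. -/
def hist {N : ℕ} [MeasurableSpace Ω] (x a : ℕ → Ω → Fin N → ℝ) (t : ℕ) :
    MeasurableSpace Ω :=
  (⨆ s ∈ Finset.Icc 1 t, MeasurableSpace.comap (x s) inferInstance) ⊔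
  (⨆ s ∈ Finset.Ico 1 t, MeasurableSpace.comap (a s) inferInstance)

/-- The Random Actions (RA) opinion dynamics model. -/
structure IsRAModel {N : ℕ} [MeasurableSpace Ω] (μ : Measure Ω) (α : ℝ)
    (W : Matrix (Fin N) (Fin N) ℝ) (x a : ℕ → Ω → Fin N → ℝ) : Prop where
  isProb : IsProbabilityMeasure μ
  alpha_mem : α ∈ Set.Ioo (0 : ℝ) 1
  W_nonneg : ∀ i j, 0 ≤ W i j
  W_rowsum : ∀ i, ∑ j, W i j = 1
  x_meas : ∀ t, Measurable (x t)
  a_meas : ∀ t, Measurable (a t)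
  x_mem : ∀ t, 1 ≤ t → ∀ ω i, x t ω i ∈ Set.Icc (0 : ℝ) 1
  a_mem : ∀ t, 1 ≤ t → ∀ ω i, a t ω i = 0 ∨ a t ω i = 1
  update : ∀ t, 1 ≤ t → ∀ ω i,
    x (t + 1) ω i = (1 - α) * x t ω i + α * ∑ j, W i j * a t ω j
  bernoulli : ∀ t, 1 ≤ t → ∀ b : Fin N → Bool, ∀ H : Set Ω,
    MeasurableSet[hist x a t] H →
    (μ (H ∩ {ω | ∀ i, a t ω i = if b i then (1 : ℝ) else 0})).toReal
      = ∫ ω in H, ∏ i, (if b i then x t ω i else 1 - x t ω i) ∂μ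

/-- `W` is irreducible: the network is strongly connected. -/
def Irreducible {N : ℕ} (W : Matrix (Fin N) (Fin N) ℝ) : Prop :=
  ∀ i j, ∃ n : ℕ, 0 < (W ^ n) i j

/-- The event that `x t i ∈ [0,δ) ∪ (1-δ,1]`. -/
def cti {N : ℕ} (x : ℕ → Ω → Fin N → ℝ) (δ : ℝ) (t : ℕ) (i : Fin N) : Set Ω :=
  {ω | x t ω i < δ ∨ 1 - δ < x t ω i}

def ct {N : ℕ} (x : ℕ → Ω → Fin N → ℝ) (δ : ℝ) (t : ℕ) : Set Ω :=
  ⋂ i, cti x δ t i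

def c0 {N : ℕ} (x : ℕ → Ω → Fin N → ℝ) (δ : ℝ) (t : ℕ) (i : Fin N) : Set Ω :=
  {ω | x t ω i < δ}

def c1 {N : ℕ} (x : ℕ → Ω → Fin N → ℝ) (δ : ℝ) (t : ℕ) (i : Fin N) : Set Ω :=
  {ω | 1 - δ < x t ω i}

/-- The event that every coordinate of `x t` is within `δ` of `0`. -/
def corner0 {N : ℕ} (x : ℕ → Ω → Fin N → ℝ) (δ : ℝ) (t : ℕ) : Set Ω :=
  {ω | ∀ i, x t ω i < δ}

/-- The event that every coordinate of `x t` is within `δ` of `1`. -/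
def corner1 {N : ℕ} (x : ℕ → Ω → Fin N → ℝ) (δ : ℝ) (t : ℕ) : Set Ω :=
  {ω | ∀ i, 1 - δ < x t ω i}

/-- Agents `i` and `j` communicate. -/
def Communicates {N : ℕ} (W : Matrix (Fin N) (Fin N) ℝ) (i j : Fin N) : Prop :=
  (∃ n : ℕ, 0 < (W ^ n) j i) ∧ (∃ n : ℕ, 0 < (W ^ n) i j)

/-- `C` is a communication class (strongly connected component). -/
def CommClass {N : ℕ} (W : Matrix (Fin N) (Fin N) ℝ) (C : Set (Fin N)) : Prop :=
  ∃ i, C = {j | Communicates W i j}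

/-- `C` is a maximal communication class: no agent outside `C` has a directed
path into `C`. -/
def IsMaximalClass {N : ℕ} (W : Matrix (Fin N) (Fin N) ℝ) (C : Set (Fin N)) : Prop :=
  CommClass W C ∧ ∀ i ∈ C, ∀ j, (∃ n : ℕ, 0 < (W ^ n) i j) → j ∈ C

theorem exists_pos_vecMul_eq_self {N : ℕ} (hN : 1 ≤ N) {W : Matrix (Fin N) (Fin N) ℝ}
    (hnn : ∀ i j, 0 ≤ W i j) (hrow : ∀ i, ∑ j, W i j = 1) (hirr : Irreducible W) :
    ∃ v : Fin N → ℝ, (∀ i, 0 < v i) ∧ Matrix.vecMul v W = v := by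
  have hdet : (W - 1).det = 0 := by
    refine Matrix.exists_mulVec_eq_zero_iff.mp ⟨fun _ => 1, fun h => ?_, ?_⟩
    · exact one_ne_zero (congrFun h ⟨0, hN⟩)
    · ext i
      simp [Matrix.mulVec, dotProduct, hrow, Matrix.one_apply]
  obtain ⟨v, hv0, hv⟩ := Matrix.exists_vecMul_eq_zero_iff.mpr hdet
  rw [Matrix.vecMul_sub, Matrix.vecMul_one, sub_eq_zero] at hv
  have hvj : ∀ j, ∑ i, v i * W i j = v j := fun j => congrFun hv j
  have hle : ∀ j ∈ Finset.univ, |v j| ≤ ∑ i, |v i| * W i j := fun j _ => by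
    rw [← hvj j]
    refine (Finset.abs_sum_le_sum_abs _ _).trans_eq (Finset.sum_congr rfl fun i _ => ?_)
    rw [abs_mul, abs_of_nonneg (hnn i j)]
  have hsum : ∑ j, |v j| = ∑ j, ∑ i, |v i| * W i j := by
    rw [Finset.sum_comm]
    simp [← Finset.mul_sum, hrow]
  have habs : Matrix.vecMul (fun i => |v i|) W = fun i => |v i| := by
    ext j
    exact ((Finset.sum_eq_sum_iff_of_le hle).mp hsum j (Finset.mem_univ j)).symm
  have hpow : ∀ n : ℕ, Matrix.vecMul (fun i => |v i|) (W ^ n) = fun i => |v i| := by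
    intro n
    induction n with
    | zero => simp
    | succ n ih => rw [pow_succ, ← Matrix.vecMul_vecMul, ih, habs]
  have hpownn : ∀ (n : ℕ) i j, 0 ≤ (W ^ n) i j := by
    intro n
    induction n with
    | zero => intro i j; simp only [pow_zero, Matrix.one_apply]; split_ifs <;> norm_num
    | succ n ih =>
      intro i j
      rw [pow_succ, Matrix.mul_apply]
      exact Finset.sum_nonneg fun k _ => mul_nonneg (ih i k) (hnn k j)
  obtain ⟨k, hk⟩ := Function.ne_iff.mp hv0
  refine ⟨fun i => |v i|, fun j => ?_, habs⟩
  obtain ⟨n, hn⟩ := hirr k j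
  calc 0 < |v k| * (W ^ n) k j := mul_pos (abs_pos.mpr hk) hn
    _ ≤ ∑ i, |v i| * (W ^ n) i j :=
        Finset.single_le_sum (f := fun i => |v i| * (W ^ n) i j)
          (fun i _ => mul_nonneg (abs_nonneg _) (hpownn n i j)) (Finset.mem_univ k)
    _ = |v j| := congrFun (hpow n) j

/-- Probability that independent Bernoulli variables with parameters `p` take the values `b`. -/
def bernoulliWeight {N : ℕ} (p : Fin N → ℝ) (b : Fin N → Bool) : ℝ :=
  ∏ i, if b i then p i else 1 - p i

theorem bernoulliWeight_nonneg {N : ℕ} {p : Fin N → ℝ} (hp : ∀ i, p i ∈ Set.Icc (0 : ℝ) 1)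
    (b : Fin N → Bool) : 0 ≤ bernoulliWeight p b := by
  refine Finset.prod_nonneg fun i _ => ?_
  have := hp i
  split_ifs
  · exact this.1
  · linarith [this.2]

theorem bernoulliWeight_le_one {N : ℕ} {p : Fin N → ℝ} (hp : ∀ i, p i ∈ Set.Icc (0 : ℝ) 1)
    (b : Fin N → Bool) : bernoulliWeight p b ≤ 1 := by
  refine Finset.prod_le_one (fun i _ => ?_) fun i _ => ?_ <;>
  · have := hp i
    split_ifs <;> linarith [this.1, this.2]

theorem measurable_bernoulliWeight {N : ℕ} (b : Fin N → Bool) :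
    Measurable fun p : Fin N → ℝ => bernoulliWeight p b := by
  refine Finset.measurable_prod _ fun i _ => ?_
  cases b i <;> simp <;> fun_prop

/-- Second moment of a constant plus a linear combination of centred independent Bernoulli
variables. -/
theorem sum_bernoulliWeight_mul_sq {N : ℕ} (p w : Fin N → ℝ) (c : ℝ) :
    ∑ b, bernoulliWeight p b * (c + ∑ j, w j * ((if b j then 1 else 0) - p j)) ^ 2 =
      c ^ 2 + ∑ j, w j ^ 2 * (p j * (1 - p j)) := by
  induction N generalizing c with
  | zero => simp [bernoulliWeight]
  | succ n ih =>
    have hcons : ∀ e : Bool, ∑ b : Fin n → Bool, bernoulliWeight p (Fin.cons e b) *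
          (c + ∑ j, w j * ((if (Fin.cons e b : Fin (n + 1) → Bool) j then 1 else 0) - p j)) ^ 2 =
        (if e then p 0 else 1 - p 0) * ((c + w 0 * ((if e then 1 else 0) - p 0)) ^ 2 +
          ∑ j : Fin n, w j.succ ^ 2 * (p j.succ * (1 - p j.succ))) := by
      intro e
      rw [← ih (fun j => p j.succ) (fun j => w j.succ), Finset.mul_sum]
      refine Finset.sum_congr rfl fun b _ => ?_
      simp only [bernoulliWeight, Fin.prod_univ_succ, Fin.sum_univ_succ, Fin.cons_zero,
        Fin.cons_succ]
      ring
    rw [← (Fin.consEquiv fun _ : Fin (n + 1) => Bool).sum_comp, Fintype.sum_prod_type]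
    refine (Finset.sum_congr rfl fun e _ => hcons e).trans ?_
    rw [Fin.sum_univ_succ, Fintype.sum_bool]
    simp only [if_true, Bool.false_eq_true, if_false]
    ring

section Model

variable [MeasurableSpace Ω] {N : ℕ} {μ : Measure Ω} {α : ℝ} {W : Matrix (Fin N) (Fin N) ℝ}
  {x a : ℕ → Ω → Fin N → ℝ}

/-- The event that the actions at time `t` are given by `b`. -/
def actionEvent (a : ℕ → Ω → Fin N → ℝ) (t : ℕ) (b : Fin N → Bool) : Set Ω :=
  {ω | ∀ i, a t ω i = if b i then (1 : ℝ) else 0}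

theorem IsRAModel.measurableSet_actionEvent (h : IsRAModel μ α W x a) (t : ℕ)
    (b : Fin N → Bool) : MeasurableSet (actionEvent a t b) := by
  simp only [actionEvent, Set.ofPred_forall]
  exact MeasurableSet.iInter fun i =>
    measurableSet_eq_fun ((measurable_pi_apply i).comp (h.a_meas t)) measurable_const

theorem IsRAModel.integrable_comp (h : IsRAModel μ α W x a) {t : ℕ} (ht : 1 ≤ t)
    {F : (Fin N → ℝ) → ℝ} (hF : Measurable F) {C : ℝ}
    (hC : ∀ p : Fin N → ℝ, (∀ i, p i ∈ Set.Icc (0 : ℝ) 1) → |F p| ≤ C) :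
    Integrable (fun ω => F (x t ω)) μ := by
  have := h.isProb
  exact Integrable.of_bound (hF.comp (h.x_meas t)).aestronglyMeasurable C
    (ae_of_all _ fun ω => hC _ (h.x_mem t ht ω))

theorem IsRAModel.integrable_bernoulliWeight (h : IsRAModel μ α W x a) {t : ℕ} (ht : 1 ≤ t)
    (b : Fin N → Bool) : Integrable (fun ω => bernoulliWeight (x t ω) b) μ :=
  h.integrable_comp ht (measurable_bernoulliWeight b) (C := 1) fun p hp => by
    rw [abs_of_nonneg (bernoulliWeight_nonneg hp b)]
    exact bernoulliWeight_le_one hp b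

theorem IsRAModel.map_restrict_actionEvent (h : IsRAModel μ α W x a) {t : ℕ} (ht : 1 ≤ t)
    (b : Fin N → Bool) :
    (μ.restrict (actionEvent a t b)).map (x t) =
      (μ.withDensity fun ω => ENNReal.ofReal (bernoulliWeight (x t ω) b)).map (x t) := by
  have := h.isProb
  ext S hS
  have hpre := h.x_meas t hS
  have hhist : MeasurableSet[hist x a t] (x t ⁻¹' S) := by
    have hle : MeasurableSpace.comap (x t) inferInstance ≤ hist x a t :=
      le_sup_of_le_left (le_iSup₂_of_le t (Finset.mem_Icc.mpr ⟨ht, le_rfl⟩) le_rfl)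
    exact hle _ ⟨S, hS, rfl⟩
  rw [Measure.map_apply (h.x_meas t) hS, Measure.map_apply (h.x_meas t) hS,
    Measure.restrict_apply hpre, withDensity_apply _ hpre,
    ← ofReal_integral_eq_lintegral_ofReal (h.integrable_bernoulliWeight ht b).integrableOn
      (ae_of_all _ fun ω => bernoulliWeight_nonneg (h.x_mem t ht ω) b),
    ← ENNReal.ofReal_toReal (measure_ne_top μ _)]
  exact congrArg ENNReal.ofReal (h.bernoulli t ht b _ hhist)

theorem IsRAModel.setIntegral_actionEvent (h : IsRAModel μ α W x a) {t : ℕ} (ht : 1 ≤ t)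
    (b : Fin N → Bool) {F : (Fin N → ℝ) → ℝ} (hF : Measurable F) :
    ∫ ω in actionEvent a t b, F (x t ω) ∂μ = ∫ ω, bernoulliWeight (x t ω) b * F (x t ω) ∂μ := by
  have hw : Measurable fun ω => ENNReal.ofReal (bernoulliWeight (x t ω) b) :=
    ((measurable_bernoulliWeight b).comp (h.x_meas t)).ennreal_ofReal
  rw [← integral_map (h.x_meas t).aemeasurable hF.aestronglyMeasurable,
    h.map_restrict_actionEvent ht b,
    integral_map (h.x_meas t).aemeasurable hF.aestronglyMeasurable,
    integral_withDensity_eq_integral_toReal_smul hw (by simp)]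
  refine integral_congr_ae (ae_of_all _ fun ω => ?_)
  simp [ENNReal.toReal_ofReal (bernoulliWeight_nonneg (h.x_mem t ht ω) b)]

theorem IsRAModel.integral_sq_succ (h : IsRAModel μ α W x a) {v : Fin N → ℝ}
    (hv : Matrix.vecMul v W = v) {t : ℕ} (ht : 1 ≤ t) :
    ∫ ω, (∑ j, v j * x (t + 1) ω j) ^ 2 ∂μ = ∫ ω, (∑ j, v j * x t ω j) ^ 2 ∂μ +
      ∑ j, (α * v j) ^ 2 * ∫ ω, x t ω j * (1 - x t ω j) ∂μ := by
  have := h.isProb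
  have hvj : ∀ j, ∑ i, v i * W i j = v j := fun j => congrFun hv j
  have hstep : ∀ ω, ∑ j, v j * x (t + 1) ω j =
      ∑ j, v j * x t ω j + ∑ j, α * v j * (a t ω j - x t ω j) := by
    intro ω
    have hWa : ∑ i, v i * ∑ j, W i j * a t ω j = ∑ j, v j * a t ω j := by
      simp_rw [Finset.mul_sum]
      rw [Finset.sum_comm]
      refine Finset.sum_congr rfl fun j _ => ?_
      rw [← hvj j, Finset.sum_mul]
      exact Finset.sum_congr rfl fun i _ => by ring
    have hα : ∑ j, α * v j * (a t ω j - x t ω j) =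
        α * ∑ i, v i * ∑ j, W i j * a t ω j - α * ∑ j, v j * x t ω j := by
      rw [hWa, Finset.mul_sum, Finset.mul_sum, ← Finset.sum_sub_distrib]
      exact Finset.sum_congr rfl fun j _ => by ring
    rw [hα, Finset.mul_sum, Finset.mul_sum, ← Finset.sum_sub_distrib, ← Finset.sum_add_distrib]
    exact Finset.sum_congr rfl fun j _ => by rw [h.update t ht]; ring
  let G : (Fin N → Bool) → (Fin N → ℝ) → ℝ := fun b p =>
    (∑ j, v j * p j + ∑ j, α * v j * ((if b j then 1 else 0) - p j)) ^ 2
  have hGcont : ∀ b, Continuous (G b) := fun b => by fun_prop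
  have hcompact : IsCompact (Set.univ.pi fun _ : Fin N => Set.Icc (0 : ℝ) 1) :=
    isCompact_univ_pi fun _ => isCompact_Icc
  have hint : ∀ F : (Fin N → ℝ) → ℝ, Continuous F → Integrable (fun ω => F (x t ω)) μ := by
    intro F hF
    obtain ⟨C, hC⟩ := hcompact.exists_bound_of_continuousOn hF.continuousOn
    exact h.integrable_comp ht hF.measurable fun p hp => hC p fun i _ => hp i
  have hwcont : ∀ b : Fin N → Bool, Continuous fun p : Fin N → ℝ => bernoulliWeight p b := by
    intro b
    refine continuous_finsetProd _ fun i _ => ?_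
    cases b i <;> simp <;> fun_prop
  have hdisj : Pairwise (Function.onFun Disjoint (actionEvent a t)) := by
    intro b c hbc
    refine Set.disjoint_left.mpr fun ω hb hc => hbc (funext fun i => ?_)
    have := (hb i).symm.trans (hc i)
    cases hbi : b i <;> cases hci : c i <;> simp_all
  have hunion : ⋃ b, actionEvent a t b = Set.univ := by
    refine Set.eq_univ_of_forall fun ω => Set.mem_iUnion.mpr ⟨fun i => decide (a t ω i = 1), ?_⟩
    intro i
    rcases h.a_mem t ht ω i with hi | hi <;> simp [hi]
  have hG : ∀ b, Set.EqOn (fun ω => (∑ j, v j * x (t + 1) ω j) ^ 2) (fun ω => G b (x t ω))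
      (actionEvent a t b) := by
    intro b ω hω
    simp only [G, hstep ω]
    congr 3 with j
    rw [hω j]
  have hms := h.measurableSet_actionEvent t
  calc ∫ ω, (∑ j, v j * x (t + 1) ω j) ^ 2 ∂μ
      = ∑ b, ∫ ω in actionEvent a t b, (∑ j, v j * x (t + 1) ω j) ^ 2 ∂μ := by
        rw [← integral_iUnion_fintype hms hdisj, hunion, setIntegral_univ]
        exact fun b => (integrableOn_congr_fun (hG b) (hms b)).mpr (hint _ (hGcont b)).integrableOn
    _ = ∑ b, ∫ ω, bernoulliWeight (x t ω) b * G b (x t ω) ∂μ :=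
        Finset.sum_congr rfl fun b _ => by
          rw [setIntegral_congr_fun (hms b) (hG b),
            h.setIntegral_actionEvent ht b (hGcont b).measurable]
    _ = ∫ ω, ((∑ j, v j * x t ω j) ^ 2 +
          ∑ j, (α * v j) ^ 2 * (x t ω j * (1 - x t ω j))) ∂μ := by
        rw [← integral_finsetSum _ fun b _ =>
          hint (fun p => bernoulliWeight p b * G b p) ((hwcont b).mul (hGcont b))]
        exact integral_congr_ae (ae_of_all _ fun ω =>
          sum_bernoulliWeight_mul_sq (x t ω) (fun j => α * v j) _)
    _ = _ := by
        rw [integral_add (hint (fun p => (∑ j, v j * p j) ^ 2) (by fun_prop))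
            (hint (fun p => ∑ j, (α * v j) ^ 2 * (p j * (1 - p j))) (by fun_prop)),
          integral_finsetSum _ fun j _ =>
            hint (fun p => (α * v j) ^ 2 * (p j * (1 - p j))) (by fun_prop)]
        simp only [integral_const_mul]

theorem IsRAModel.tendsto_integral_mul_one_sub (h : IsRAModel μ α W x a) {v : Fin N → ℝ}
    (hpos : ∀ i, 0 < v i) (hv : Matrix.vecMul v W = v) (i : Fin N) :
    Tendsto (fun t => ∫ ω, x t ω i * (1 - x t ω i) ∂μ) atTop (nhds 0) := by
  have := h.isProb
  have hα := h.alpha_mem.1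
  set D : ℕ → ℝ := fun t => ∫ ω, (∑ j, v j * x (t + 1) ω j) ^ 2 ∂μ with hD
  set V : ℕ → Fin N → ℝ := fun t j => ∫ ω, x (t + 1) ω j * (1 - x (t + 1) ω j) ∂μ with hV
  have hVnn : ∀ t j, 0 ≤ V t j := fun t j => integral_nonneg fun ω =>
    mul_nonneg (h.x_mem _ t.succ_pos ω j).1 (sub_nonneg.mpr (h.x_mem _ t.succ_pos ω j).2)
  have hsucc : ∀ t, D (t + 1) = D t + ∑ j, (α * v j) ^ 2 * V t j := fun t =>
    h.integral_sq_succ hv t.succ_pos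
  have hterm : ∀ t j, 0 ≤ (α * v j) ^ 2 * V t j := fun t j => mul_nonneg (sq_nonneg _) (hVnn t j)
  have hmono : Monotone D := monotone_nat_of_le_succ fun t => by
    rw [hsucc]
    exact le_add_of_nonneg_right (Finset.sum_nonneg fun j _ => hterm t j)
  have hbdd : BddAbove (Set.range D) := by
    refine ⟨(∑ j, v j) ^ 2, ?_⟩
    rintro _ ⟨t, rfl⟩
    refine (integral_mono_of_nonneg (ae_of_all _ fun ω => sq_nonneg _)
      (integrable_const ((∑ j, v j) ^ 2)) (ae_of_all _ fun ω => ?_)).trans_eq (by simp)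
    have hx := h.x_mem (t + 1) t.succ_pos ω
    exact pow_le_pow_left₀ (Finset.sum_nonneg fun j _ => mul_nonneg (hpos j).le (hx j).1)
      (Finset.sum_le_sum fun j _ => mul_le_of_le_one_right (hpos j).le (hx j).2) 2
  have hlim := tendsto_atTop_ciSup hmono hbdd
  have hdiff : Tendsto (fun t => (D (t + 1) - D t) / (α * v i) ^ 2) atTop (nhds 0) := by
    simpa using (((tendsto_add_atTop_iff_nat 1).mpr hlim).sub hlim).div_const ((α * v i) ^ 2)
  refine (tendsto_add_atTop_iff_nat 1).mp (squeeze_zero (fun t => hVnn t i) (fun t => ?_) hdiff)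
  rw [le_div_iff₀ (pow_pos (mul_pos hα (hpos i)) 2), hsucc, add_sub_cancel_left, mul_comm]
  exact Finset.single_le_sum (f := fun j => (α * v j) ^ 2 * V t j) (fun j _ => hterm t j)
    (Finset.mem_univ i)

end Model

theorem prob_cti_tendsto_one {Ω : Type*} [MeasurableSpace Ω] {N : ℕ} (hN : 1 ≤ N)
    (μ : Measure Ω) (α : ℝ) (W : Matrix (Fin N) (Fin N) ℝ)
    (x a : ℕ → Ω → Fin N → ℝ) (hRA : IsRAModel μ α W x a)
    (hirr : Irreducible W) :
    ∀ δ ∈ Set.Ioo (0 : ℝ) (1/2), ∀ i : Fin N,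
      Filter.Tendsto (fun t => (μ (cti x δ t i)).toReal)
        Filter.atTop (nhds 1) := by
  intro δ hδ i
  have := hRA.isProb
  obtain ⟨v, hpos, hv⟩ := exists_pos_vecMul_eq_self hN hRA.W_nonneg hRA.W_rowsum hirr
  have hlim := hRA.tendsto_integral_mul_one_sub hpos hv i
  have hδ1 : 0 < δ * (1 - δ) := mul_pos hδ.1 (by linarith [hδ.2])
  have hxi : ∀ t, Measurable fun ω => x t ω i := fun t =>
    (measurable_pi_apply i).comp (hRA.x_meas t)
  have hmeas : ∀ t, MeasurableSet (cti x δ t i) := fun t =>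
    (measurableSet_lt (hxi t) measurable_const).union (measurableSet_lt measurable_const (hxi t))
  have hlower : Tendsto (fun t => 1 - (∫ ω, x t ω i * (1 - x t ω i) ∂μ) / (δ * (1 - δ)))
      atTop (nhds 1) := by
    simpa using (hlim.div_const (δ * (1 - δ))).const_sub 1
  refine tendsto_of_tendsto_of_tendsto_of_le_of_le' hlower tendsto_const_nhds ?_
    (Eventually.of_forall fun t => measureReal_le_one)
  filter_upwards [eventually_ge_atTop 1] with t ht
  have hmarkov := mul_meas_ge_le_integral_of_nonneg (μ := μ)
    (f := fun ω => x t ω i * (1 - x t ω i))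
    (ae_of_all _ fun ω => mul_nonneg (hRA.x_mem t ht ω i).1
      (sub_nonneg.mpr (hRA.x_mem t ht ω i).2))
    (hRA.integrable_comp ht (F := fun p => p i * (1 - p i)) (by fun_prop) (C := 1) fun p hp => by
      have := hp i
      rw [abs_le]
      constructor <;> nlinarith [this.1, this.2])
    (δ * (1 - δ))
  have hsub : (cti x δ t i)ᶜ ⊆ {ω | δ * (1 - δ) ≤ x t ω i * (1 - x t ω i)} := by
    intro ω hω
    simp only [cti, Set.mem_compl_iff, Set.mem_ofPred_eq, not_or, not_lt] at hω
    simp only [Set.mem_ofPred_eq]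
    nlinarith [mul_nonneg (sub_nonneg.mpr hω.1) (sub_nonneg.mpr hω.2)]
  have hcompl : μ.real (cti x δ t i)ᶜ = 1 - μ.real (cti x δ t i) :=
    probReal_compl_eq_one_sub (hmeas t)
  have hle : 1 - μ.real (cti x δ t i) ≤
      (∫ ω, x t ω i * (1 - x t ω i) ∂μ) / (δ * (1 - δ)) := by
    rw [← hcompl, le_div_iff₀ hδ1, mul_comm]
    exact (mul_le_mul_of_nonneg_left (measureReal_mono hsub) hδ1.le).trans hmarkov
  change _ ≤ μ.real (cti x δ t i)
  linarith

end RA
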